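/- Let A be a four-dimensional power-commutative real division algebra containing no nonzero central idempotent, let a, b ∈ A be nonzero idempotents with ab ≠ ba, and let e be a nonzero idempotent such that (a − b)² is a nonzero scalar multiple of e. Then e is exceptional: its centraliser C(e) is three-dimensional and closed under the squaring map x ↦ x². -/

import Mathlib

open Module

section Defs

variable {A : Type*} [AddCommGroup A] [Module ℝ A]

/-- A linear subspace closed under the multiplication `m`. -/
def IsSubalg (m : A →ₗ[ℝ] A →ₗ[ℝ] A) (U : Submodule ℝ A) : Prop :=
  ∀ x ∈ U, ∀ y ∈ U, m x y ∈ U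

/-- The subalgebra generated by a set `s`: the smallest subspace containing `s`
and closed under multiplication. -/
def genSubalg (m : A →ₗ[ℝ] A →ₗ[ℝ] A) (s : Set A) : Submodule ℝ A :=
  sInf {U : Submodule ℝ A | IsSubalg m U ∧ s ⊆ (U : Set A)}

/-- `m` is a division-algebra multiplication: for nonzero `a`, both left and
right multiplication by `a` are bijective. -/
def IsDivision (m : A →ₗ[ℝ] A →ₗ[ℝ] A) : Prop :=
  ∀ a : A, a ≠ 0 →
    Function.Bijective (fun x : A => m a x) ∧ Function.Bijective (fun x : A => m x a)

/-- Power-commutativity: every subalgebra generated by a single element is commutative. -/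
def PowerComm (m : A →ₗ[ℝ] A →ₗ[ℝ] A) : Prop :=
  ∀ x : A, ∀ a ∈ genSubalg m {x}, ∀ b ∈ genSubalg m {x}, m a b = m b a

/-- An omnipresent idempotent: a nonzero idempotent contained in every
two-dimensional subalgebra. -/
def Omnipresent (m : A →ₗ[ℝ] A →ₗ[ℝ] A) (e : A) : Prop :=
  e ≠ 0 ∧ m e e = e ∧
    ∀ U : Submodule ℝ A, IsSubalg m U → Module.finrank ℝ U = 2 → e ∈ U

/-- `one` is an identity element for `m` and for every `x` the elements
`one, x, x²` are linearly dependent. -/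
def IsQuadraticWith (m : A →ₗ[ℝ] A →ₗ[ℝ] A) (one : A) : Prop :=
  (∀ x : A, m one x = x ∧ m x one = x) ∧
    ∀ x : A, ¬ LinearIndependent ℝ ![one, x, m x x]

/-- A quadratic algebra: unital, and `1, x, x²` linearly dependent for all `x`. -/
def IsQuadratic (m : A →ₗ[ℝ] A →ₗ[ℝ] A) : Prop :=
  ∃ one : A, IsQuadraticWith m one

/-- The isotope multiplication `x ∘ y = (T x)·(T y)`. -/
def isotope (m : A →ₗ[ℝ] A →ₗ[ℝ] A) (T : A →ₗ[ℝ] A) : A →ₗ[ℝ] A →ₗ[ℝ] A :=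
  (m.compl₂ T).comp T

/-- A planar map on a quadratic division algebra with identity `one`:
invertible, fixes `one`, and leaves every subalgebra invariant. -/
def Planar (m : A →ₗ[ℝ] A →ₗ[ℝ] A) (one : A) (T : A →ₗ[ℝ] A) : Prop :=
  Function.Bijective T ∧ T one = one ∧
    ∀ U : Submodule ℝ A, IsSubalg m U → ∀ x ∈ U, T x ∈ U

/-- The imaginary space `Im B = {x ∉ ℝ·1 : x² ∈ ℝ·1} ∪ {0}` of a quadratic algebra. -/
def ImSet (m : A →ₗ[ℝ] A →ₗ[ℝ] A) (one : A) : Set A :=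
  {x : A | x ∉ Submodule.span ℝ {one} ∧ m x x ∈ Submodule.span ℝ {one}} ∪ {0}

/-- The centraliser `C(e) = {y : e·y = y·e}`, a linear subspace. -/
def centraliser (m : A →ₗ[ℝ] A →ₗ[ℝ] A) (e : A) : Submodule ℝ A :=
  LinearMap.ker (m e - m.flip e)

/-- An exceptional idempotent of a four-dimensional algebra: its centraliser is
three-dimensional and closed under squaring. -/
def Exceptional (m : A →ₗ[ℝ] A →ₗ[ℝ] A) (e : A) : Prop :=
  Module.finrank ℝ (centraliser m e) = 3 ∧
    ∀ x ∈ centraliser m e, m x x ∈ centraliser m e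

end Defs

section Commutation

variable {A : Type*} [AddCommGroup A] [Module ℝ A] {m : A →ₗ[ℝ] A →ₗ[ℝ] A}

theorem mem_centraliser {e y : A} : y ∈ centraliser m e ↔ m e y = m y e := by
  simp [centraliser, sub_eq_zero]

theorem subset_genSubalg (s : Set A) : s ⊆ (genSubalg m s : Set A) := fun _ hx =>
  Submodule.mem_sInf.2 fun _ hU => hU.2 hx

theorem isSubalg_genSubalg (s : Set A) : IsSubalg m (genSubalg m s) := fun _ hx _ hy =>
  Submodule.mem_sInf.2 fun U hU =>
    hU.1 _ (Submodule.mem_sInf.1 hx U hU) _ (Submodule.mem_sInf.1 hy U hU)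

theorem PowerComm.mul_sq (hpc : PowerComm m) (x : A) : m x (m x x) = m (m x x) x :=
  have hx : x ∈ genSubalg m {x} := subset_genSubalg _ rfl
  hpc x x hx _ (isSubalg_genSubalg _ x hx x hx)

/-- The polarisation of `[x, x²] = 0` at two idempotents. -/
theorem PowerComm.commutator_idempotents (hpc : PowerComm m) {a b : A}
    (haa : m a a = a) (hbb : m b b = b) :
    m b (m a b + m b a) + m a b = m (m a b + m b a) b + m b a := by
  have h₁ := hpc.mul_sq (a + b)
  have h₂ := hpc.mul_sq (a - b)
  simp only [map_add, map_sub, LinearMap.add_apply, LinearMap.sub_apply, haa, hbb] at h₁ h₂ ⊢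
  linear_combination (norm := module) (1 / 2 : ℝ) • h₁ + (1 / 2 : ℝ) • h₂

theorem PowerComm.sq_sub_mem_centraliser (hpc : PowerComm m) {a b : A}
    (haa : m a a = a) (hbb : m b b = b) : m (a - b) (a - b) ∈ centraliser m b := by
  have h := hpc.commutator_idempotents haa hbb
  rw [mem_centraliser]
  simp only [map_add, map_sub, LinearMap.add_apply, LinearMap.sub_apply, haa, hbb] at h ⊢
  linear_combination (norm := module) (-1 : ℝ) • h

theorem PowerComm.mul_mem_centraliser (hpc : PowerComm m) {a e : A}
    (haa : m a a = a) (hee : m e e = e) (hae : m e a = m a e) :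
    m a e ∈ centraliser m e := by
  have h := hpc.commutator_idempotents haa hee
  rw [mem_centraliser]
  simp only [map_add, LinearMap.add_apply, hae] at h
  linear_combination (norm := module) (1 / 2 : ℝ) • h

end Commutation

/-- In a four-dimensional power-commutative real division algebra with
no nonzero central idempotent, if `a`, `b` are nonzero non-commuting idempotents and
`(a − b)²` is a nonzero scalar multiple of the nonzero idempotent `e`, then `e` is
exceptional. -/
theorem stmt_17 {A : Type*} [AddCommGroup A] [Module ℝ A] [FiniteDimensional ℝ A]
    (m : A →ₗ[ℝ] A →ₗ[ℝ] A)
    (hdim : Module.finrank ℝ A = 4)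
    (hdiv : IsDivision m) (hpc : PowerComm m)
    (hnc : ¬ ∃ c : A, c ≠ 0 ∧ m c c = c ∧ centraliser m c = ⊤)
    (a b : A) (ha : a ≠ 0) (haa : m a a = a) (hb : b ≠ 0) (hbb : m b b = b)
    (hab : m a b ≠ m b a)
    (e : A) (he : e ≠ 0) (hee : m e e = e)
    (μ : ℝ) (hμ : μ ≠ 0) (hsq : m (a - b) (a - b) = μ • e) :
    Exceptional m e := by
  have hbe : m b e = m e b := by
    have h := mem_centraliser.1 (hpc.sq_sub_mem_centraliser haa hbb)
    rw [hsq, map_smul, map_smul, LinearMap.smul_apply] at h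
    exact smul_right_injective A hμ h
  have hae : m a e = m e a := by
    have h := mem_centraliser.1 (hpc.sq_sub_mem_centraliser hbb haa)
    have hneg : m (b - a) (b - a) = m (a - b) (a - b) := by
      rw [← neg_sub a b, LinearMap.map_neg₂, map_neg, neg_neg]
    rw [hneg, hsq, map_smul, map_smul, LinearMap.smul_apply] at h
    exact smul_right_injective A hμ h
  have hli : LinearIndependent ℝ ![a, b, e] := by
    rw [Fintype.linearIndependent_iff]
    intro g hg
    simp only [Fin.sum_univ_three, Matrix.cons_val] at hg
    have hd : m a b - m b a ≠ 0 := sub_ne_zero.2 hab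
    have h₁ : g 1 = 0 := by
      have hl := congrArg (m a) hg
      have hr := congrArg (m.flip a) hg
      simp only [map_add, map_smul, map_zero, LinearMap.flip_apply] at hl hr
      refine (smul_eq_zero.1 (?_ : g 1 • (m a b - m b a) = 0)).resolve_right hd
      linear_combination (norm := module) hl - hr - g 2 • hae
    have h₀ : g 0 = 0 := by
      have hl := congrArg (m b) hg
      have hr := congrArg (m.flip b) hg
      simp only [map_add, map_smul, map_zero, LinearMap.flip_apply] at hl hr
      refine (smul_eq_zero.1 (?_ : g 0 • (m a b - m b a) = 0)).resolve_right hd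
      linear_combination (norm := module) hr - hl + g 2 • hbe
    have h₂ : g 2 = 0 := by
      rw [h₀, h₁, zero_smul, zero_smul, zero_add, zero_add] at hg
      exact (smul_eq_zero.1 hg).resolve_right he
    intro i
    fin_cases i <;> assumption
  have hle : Submodule.span ℝ (Set.range ![a, b, e]) ≤ centraliser m e := by
    rw [Submodule.span_le]
    rintro _ ⟨i, rfl⟩
    fin_cases i
    exacts [mem_centraliser.2 hae.symm, mem_centraliser.2 hbe.symm, mem_centraliser.2 rfl]
  have hspan : finrank ℝ (Submodule.span ℝ (Set.range ![a, b, e])) = 3 := by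
    simpa using finrank_span_eq_card hli
  have hlt : finrank ℝ (centraliser m e) < 4 :=
    hdim ▸ Submodule.finrank_lt fun h => hnc ⟨e, he, hee, h⟩
  have hrank : finrank ℝ (centraliser m e) = 3 := by
    have := Submodule.finrank_mono hle
    omega
  refine ⟨hrank, fun x hx => ?_⟩
  rw [← Submodule.eq_of_le_of_finrank_eq hle (hspan.trans hrank.symm),
    Submodule.mem_span_range_iff_exists_fun] at hx
  obtain ⟨g, rfl⟩ := hx
  have hsum : m a b + m b a ∈ centraliser m e := by
    have h : m a b + m b a = a + b - μ • e := by
      rw [← hsq]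
      simp only [map_sub, LinearMap.sub_apply, haa, hbb]
      abel
    rw [h]
    exact sub_mem (add_mem (mem_centraliser.2 hae.symm) (mem_centraliser.2 hbe.symm))
      (Submodule.smul_mem _ _ (mem_centraliser.2 rfl))
  have hexp : m (∑ i, g i • ![a, b, e] i) (∑ i, g i • ![a, b, e] i) =
      (g 0 ^ 2) • a + (g 1 ^ 2) • b + (g 2 ^ 2) • e + (g 0 * g 1) • (m a b + m b a) +
        (2 * g 0 * g 2) • m a e + (2 * g 1 * g 2) • m b e := by
    simp only [Fin.sum_univ_three, Matrix.cons_val, map_add, map_smul, LinearMap.add_apply,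
      LinearMap.smul_apply, haa, hbb, hee, ← hae, ← hbe]
    module
  rw [hexp]
  have hmem := fun (r : ℝ) {y : A} (hy : y ∈ centraliser m e) => Submodule.smul_mem _ r hy
  exact add_mem (add_mem (add_mem (add_mem (add_mem
    (hmem _ (mem_centraliser.2 hae.symm)) (hmem _ (mem_centraliser.2 hbe.symm)))
    (hmem _ (mem_centraliser.2 rfl))) (hmem _ hsum))
    (hmem _ (hpc.mul_mem_centraliser haa hee hae.symm)))
    (hmem _ (hpc.mul_mem_centraliser hbb hee hbe.symm))
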